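/- Suppose 1/δ < γ* < +∞ and there exists c* ∈ (0,1) with ζ(c*) = γ*. Then the function G*(z) := k*·1_{z ≥ c*} on (0,1), where k* := x / ∫_{c*}^1 F_ρ^{-1}(1-z) dz, is a feasible quantile function whose objective value equals γ*·x, and its objective value is greater than or equal to the objective value of every feasible quantile function; i.e., it is optimal. -/

import Mathlib

open MeasureTheory Set Filter Topology ENNReal

noncomputable section

/-- The CDF of a random variable `ρ` under the measure `μ`. -/
def cdfFun {Ω : Type*} [MeasurableSpace Ω] (μ : Measure Ω) (ρ : Ω → ℝ) : ℝ → ℝ :=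
  fun t => (μ {ω | ρ ω ≤ t}).toReal

/-- The right-continuous quantile function of `ρ`:
`F_ρ⁻¹(z) = inf {t : F_ρ(t) > z}`. -/
def rcInv {Ω : Type*} [MeasurableSpace Ω] (μ : Measure Ω) (ρ : Ω → ℝ) : ℝ → ℝ :=
  fun z => sInf {t : ℝ | z < cdfFun μ ρ t}

/-- A feasible quantile function for pricing-density `F = F_ρ⁻¹` and initial wealth `x`:
nondecreasing and right-continuous on `(0,1)`, with `lim_{z↓0} G(z) ≥ 0`, satisfying the
budget constraint `∫_0^1 F(1-z) G(z) dz ≤ x`. -/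
def Feasible (F : ℝ → ℝ) (x : ℝ) (G : ℝ → ℝ) : Prop :=
  MonotoneOn G (Set.Ioo 0 1)
  ∧ (∀ z ∈ Set.Ioo (0:ℝ) 1, Filter.Tendsto G (nhdsWithin z (Set.Ioi z)) (nhds (G z)))
  ∧ (∃ L, 0 ≤ L ∧ Filter.Tendsto G (nhdsWithin 0 (Set.Ioi 0)) (nhds L))
  ∧ ∫⁻ z in Set.Ioo (0:ℝ) 1, ENNReal.ofReal (F (1 - z) * G z) ≤ ENNReal.ofReal x

/-- The extension `Ḡ` of a (nonnegative) quantile function `G` from `(0,1)` to `[0,1]`,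
valued in `[0,∞]`, with `Ḡ(0) = lim_{z↓0} G(z)` and `Ḡ(1) = lim_{z↑1} G(z)`
(these limits are the inf/sup over `(0,1)` since `G` is nondecreasing). -/
def Gbar (G : ℝ → ℝ) : ℝ → ℝ≥0∞ := fun z =>
  if z = 0 then ⨅ y ∈ Set.Ioo (0:ℝ) 1, ENNReal.ofReal (G y)
  else if z = 1 then ⨆ y ∈ Set.Ioo (0:ℝ) 1, ENNReal.ofReal (G y)
  else ENNReal.ofReal (G z)

/-- The objective value `∫_{[0,1]} Ḡ(z) m(dz)` of a quantile function `G`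
(for `m` a Borel probability measure carried by `[0,1]`). -/
def objVal (m : Measure ℝ) (G : ℝ → ℝ) : ℝ≥0∞ := ∫⁻ z, Gbar G z ∂m

/-- `ζ(c) = m([c,1]) / ∫_c^1 F(1-z) dz`. -/
def zeta (F : ℝ → ℝ) (m : Measure ℝ) (c : ℝ) : ℝ :=
  (m (Set.Icc c 1)).toReal / ∫ z in c..1, F (1 - z)

/-- The quantile function of an almost surely positive random variable with continuous CDF is
positive on `(0,1)`. -/
lemma rcInv_pos {Ω : Type*} [MeasurableSpace Ω] (μ : Measure Ω) [IsProbabilityMeasure μ]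
    {ρ : Ω → ℝ} (hρmeas : Measurable ρ) (hρpos : ∀ ω, 0 < ρ ω)
    (hcdf : Continuous (cdfFun μ ρ)) {z : ℝ} (hz : z ∈ Ioo (0 : ℝ) 1) : 0 < rcInv μ ρ z := by
  have : IsProbabilityMeasure (μ.map ρ) := Measure.isProbabilityMeasure_map hρmeas.aemeasurable
  have hcdf_eq : cdfFun μ ρ = ProbabilityTheory.cdf (μ.map ρ) := by
    ext t
    rw [ProbabilityTheory.cdf_eq_real, measureReal_def, Measure.map_apply hρmeas measurableSet_Iic]
    rfl
  have hmono : Monotone (cdfFun μ ρ) := by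
    rw [hcdf_eq]; exact ProbabilityTheory.monotone_cdf _
  have hzero : cdfFun μ ρ 0 = 0 := by
    have : {ω | ρ ω ≤ 0} = ∅ := by
      ext ω; simpa using hρpos ω
    simp [cdfFun, this]
  have htop : Tendsto (cdfFun μ ρ) atTop (𝓝 1) := by
    rw [hcdf_eq]; exact ProbabilityTheory.tendsto_cdf_atTop _
  obtain ⟨t, ht⟩ := (htop.eventually (lt_mem_nhds hz.2)).exists
  have hnear : ∀ᶠ s in 𝓝[>] (0 : ℝ), cdfFun μ ρ s < z :=
    (hcdf.continuousAt.eventually (gt_mem_nhds (by rw [hzero]; exact hz.1))).filter_mono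
      nhdsWithin_le_nhds
  obtain ⟨ε, hε, hε0⟩ := (hnear.and self_mem_nhdsWithin).exists
  refine lt_of_lt_of_le hε0 (le_csInf ⟨t, ht⟩ fun s hs => ?_)
  by_contra! hlt
  exact absurd (hs.trans_le (hmono hlt.le)) hε.not_gt

/-- A feasible quantile function has a nonnegative lower bound on `(0,1)`, its limit at `0`. -/
lemma Feasible.exists_lower_bound {F : ℝ → ℝ} {x : ℝ} {G : ℝ → ℝ} (hG : Feasible F x G) :
    ∃ L, 0 ≤ L ∧ Tendsto G (𝓝[>] 0) (𝓝 L) ∧ ∀ y ∈ Ioo (0 : ℝ) 1, L ≤ G y := by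
  obtain ⟨hmono, -, ⟨L, hL, hlim⟩, -⟩ := hG
  refine ⟨L, hL, hlim, fun y hy => le_of_tendsto hlim ?_⟩
  filter_upwards [Ioo_mem_nhdsGT hy.1] with w hw
  exact hmono ⟨hw.1, hw.2.trans hy.2⟩ hy hw.2.le

/-- The measure with density `γ · w` on `(0,1)`. -/
def weightMeasure (γ : ℝ) (w : ℝ → ℝ) : Measure ℝ :=
  (volume.restrict (Ioo 0 1)).withDensity fun z => ENNReal.ofReal (γ * w z)

lemma weightMeasure_Ioo {γ : ℝ} {w : ℝ → ℝ} (hγ : 0 ≤ γ) (hw : IntegrableOn w (Ioo 0 1))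
    (hpos : ∀ z ∈ Ioo (0 : ℝ) 1, 0 < w z) {c : ℝ} (hc : c ∈ Ico (0 : ℝ) 1) :
    weightMeasure γ w (Ioo c 1) = ENNReal.ofReal (γ * ∫ z in c..1, w z) := by
  have hsub : Ioo c 1 ⊆ Ioo 0 1 := Ioo_subset_Ioo_left hc.1
  rw [weightMeasure, withDensity_apply _ measurableSet_Ioo,
    Measure.restrict_restrict measurableSet_Ioo, inter_eq_left.2 hsub,
    intervalIntegral.integral_of_le hc.2.le, integral_Ioc_eq_integral_Ioo,
    ← integral_const_mul, ofReal_integral_eq_lintegral_ofReal ((hw.mono_set hsub).const_mul γ)]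
  filter_upwards [ae_restrict_mem measurableSet_Ioo] with z hz
  exact mul_nonneg hγ (hpos z (hsub hz)).le

/-- If the tails of `m` are dominated by those of the density `γ · w`, then `m` has no atom
at `1`. -/
lemma measure_singleton_one_eq_zero {γ : ℝ} {w : ℝ → ℝ} (hw : IntervalIntegrable w volume 0 1)
    {m : Measure ℝ}
    (htail : ∀ c ∈ Ioo (0 : ℝ) 1, m (Icc c 1) ≤ ENNReal.ofReal (γ * ∫ z in c..1, w z)) :
    m {1} = 0 := by
  have hint : IntegrableOn w (uIcc 0 1) := by
    rw [uIcc_of_le zero_le_one]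
    exact (intervalIntegrable_iff_integrableOn_Icc_of_le zero_le_one).1 hw
  have hcont := intervalIntegral.continuousOn_primitive_interval_left hint 1 right_mem_uIcc
  have hlim : Tendsto (fun c => ENNReal.ofReal (γ * ∫ z in c..1, w z)) (𝓝[Ioo 0 1] 1) (𝓝 0) := by
    have h := (hcont.mono_left (nhdsWithin_mono _
      (Ioo_subset_Icc_self.trans Icc_subset_uIcc))).const_mul γ
    simpa [Function.comp_def] using (ENNReal.continuous_ofReal.tendsto _).comp h
  have : (𝓝[Ioo (0 : ℝ) 1] 1).NeBot := right_nhdsWithin_Ioo_neBot one_pos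
  refine le_antisymm (ge_of_tendsto hlim ?_) zero_le
  filter_upwards [self_mem_nhdsWithin] with c hc
  exact (measure_mono (by simpa using hc.2.le)).trans (htail c hc)

/-- If the tails of `m` are dominated by those of the density `γ · w`, then the objective value
of a feasible quantile function is at most `γ · x`. -/
lemma objVal_le {γ x : ℝ} {F : ℝ → ℝ} (hγ : 0 ≤ γ)
    (hw : IntervalIntegrable (fun z => F (1 - z)) volume 0 1)
    (hpos : ∀ z ∈ Ioo (0 : ℝ) 1, 0 < F (1 - z))
    {m : Measure ℝ} [IsProbabilityMeasure m] (hm : m (Icc (0 : ℝ) 1)ᶜ = 0)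
    (htail : ∀ c ∈ Ioo (0 : ℝ) 1, m (Icc c 1) ≤ ENNReal.ofReal (γ * ∫ z in c..1, F (1 - z)))
    (htot : 1 ≤ ENNReal.ofReal (γ * ∫ z in (0 : ℝ)..1, F (1 - z)))
    {G : ℝ → ℝ} (hG : Feasible F x G) : objVal m G ≤ ENNReal.ofReal (γ * x) := by
  obtain ⟨L, hL, hlim, hLG⟩ := hG.exists_lower_bound
  obtain ⟨hmono, -, -, hbudget⟩ := hG
  set w : ℝ → ℝ := fun z => F (1 - z)
  set ν := weightMeasure γ w
  have hwint : IntegrableOn w (Ioo 0 1) :=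
    ((intervalIntegrable_iff_integrableOn_Ioc_of_le zero_le_one).1 hw).mono_set Ioo_subset_Ioc_self
  have hν : ∀ c ∈ Ico (0 : ℝ) 1, ν (Ioo c 1) = ENNReal.ofReal (γ * ∫ z in c..1, w z) :=
    fun c hc => weightMeasure_Ioo hγ hwint hpos hc
  have hνac : ν ≪ volume.restrict (Ioo 0 1) := withDensity_absolutelyContinuous _ _
  have hνae : ∀ᵐ z ∂ν, z ∈ Ioo (0 : ℝ) 1 := hνac.ae_le (ae_restrict_mem measurableSet_Ioo)
  have hmae : ∀ᵐ z ∂m, z ∈ Ico (0 : ℝ) 1 := by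
    have h1 : ∀ᵐ z ∂m, z ∈ Icc (0 : ℝ) 1 := hm
    have h2 : ∀ᵐ z ∂m, z ∉ ({1} : Set ℝ) :=
      measure_eq_zero_iff_ae_notMem.1 (measure_singleton_one_eq_zero hw htail)
    filter_upwards [h1, h2] with z hz hz1
    exact ⟨hz.1, lt_of_le_of_ne hz.2 hz1⟩
  set H : ℝ → ℝ := fun z => if z ≤ 0 then L else G z
  have hHpos : ∀ z, 0 < z → H z = G z := fun z hz => if_neg hz.not_ge
  have hHzero : H 0 = L := if_pos le_rfl
  have hHL : ∀ z ∈ Ico (0 : ℝ) 1, L ≤ H z := by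
    intro z hz
    rcases hz.1.eq_or_lt with rfl | h
    · rw [hHzero]
    · rw [hHpos z h]; exact hLG z ⟨h, hz.2⟩
  have hHmono : MonotoneOn H (Ico 0 1) := by
    intro a ha b hb hab
    rcases ha.1.eq_or_lt with rfl | h
    · rw [hHzero]; exact hHL b hb
    · rw [hHpos a h, hHpos b (h.trans_le hab)]
      exact hmono ⟨h, ha.2⟩ ⟨h.trans_le hab, hb.2⟩ hab
  have hHm : AEMeasurable H m := by
    rw [← Measure.restrict_eq_self_of_ae_mem hmae]
    exact aemeasurable_restrict_of_monotoneOn measurableSet_Ico hHmono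
  have hHvol : AEMeasurable H (volume.restrict (Ioo 0 1)) :=
    aemeasurable_restrict_of_monotoneOn measurableSet_Ioo (hHmono.mono Ioo_subset_Ico_self)
  have hbar : ∀ᵐ z ∂m, Gbar G z ≤ ENNReal.ofReal (H z) := by
    filter_upwards [hmae] with z hz
    rcases hz.1.eq_or_lt with rfl | h
    · rw [hHzero, Gbar, if_pos rfl]
      refine ge_of_tendsto ((ENNReal.continuous_ofReal.tendsto L).comp hlim) ?_
      filter_upwards [Ioo_mem_nhdsGT one_pos] with y hy
      exact iInf₂_le y hy
    · rw [hHpos z h, Gbar, if_neg h.ne', if_neg hz.2.ne]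
  have hlevel : ∀ t, m {z | t ≤ H z} ≤ ν {z | t ≤ H z} := by
    intro t
    set S : Set ℝ := {z | z ∈ Ioo (0 : ℝ) 1 ∧ t ≤ G z}
    rcases S.eq_empty_or_nonempty with hS | hS
    · have : m {z | t ≤ H z} = 0 := by
        rw [measure_eq_zero_iff_ae_notMem]
        filter_upwards [hmae] with z hz hzt
        have hhalf : (1 / 2 : ℝ) ∈ Ioo (0 : ℝ) 1 := by norm_num
        rcases hz.1.eq_or_lt with rfl | h
        · have hLt : t ≤ L := hHzero ▸ hzt
          exact eq_empty_iff_forall_notMem.1 hS _ ⟨hhalf, hLt.trans (hLG _ hhalf)⟩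
        · have hGt : t ≤ G z := hHpos z h ▸ hzt
          exact eq_empty_iff_forall_notMem.1 hS _ ⟨⟨h, hz.2⟩, hGt⟩
      rw [this]; exact zero_le
    have hbdd : BddBelow S := ⟨0, fun y hy => hy.1.1.le⟩
    have hc0 : 0 ≤ sInf S := le_csInf hS fun y hy => hy.1.1.le
    have hc1 : sInf S < 1 := by
      obtain ⟨y, hy⟩ := hS
      exact (csInf_le hbdd hy).trans_lt hy.1.2
    have hsub : Ioo (sInf S) 1 ⊆ {z | t ≤ H z} := by
      intro z hz
      obtain ⟨y, hy, hyz⟩ := exists_lt_of_csInf_lt hS hz.1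
      have hz0 : 0 < z := hc0.trans_lt hz.1
      change t ≤ H z
      rw [hHpos z hz0]
      exact hy.2.trans (hmono hy.1 ⟨hz0, hz.2⟩ hyz.le)
    refine le_trans ?_ (measure_mono hsub)
    rw [hν _ ⟨hc0, hc1⟩]
    rcases hc0.eq_or_lt with h0 | h0
    · rw [← h0]; exact prob_le_one.trans htot
    refine le_trans (measure_mono_ae ?_) (htail _ ⟨h0, hc1⟩)
    filter_upwards [hmae] with z hz hzt
    have hmem : ∀ y ∈ Ioo (0 : ℝ) 1, t ≤ G y → sInf S ≤ y :=
      fun y hy hty => csInf_le hbdd ⟨hy, hty⟩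
    refine ⟨?_, hz.2.le⟩
    rcases hz.1.eq_or_lt with rfl | h
    · have hLt : t ≤ L := hHzero ▸ hzt
      have hy : sInf S / 2 ∈ Ioo (0 : ℝ) 1 := ⟨by linarith, by linarith⟩
      have := hmem _ hy (hLt.trans (hLG _ hy))
      linarith
    · exact hmem z ⟨h, hz.2⟩ (hHpos z h ▸ hzt)
  have hmass : ∫⁻ z, ENNReal.ofReal (H z) ∂m ≤ ∫⁻ z, ENNReal.ofReal (H z) ∂ν := by
    rw [lintegral_eq_lintegral_meas_le m (hmae.mono fun z hz => hL.trans (hHL z hz)) hHm,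
      lintegral_eq_lintegral_meas_le ν
        (hνae.mono fun z hz => hL.trans (hHL z (Ioo_subset_Ico_self hz))) (hHvol.mono_ac hνac)]
    exact lintegral_mono fun t => hlevel t
  calc objVal m G ≤ ∫⁻ z, ENNReal.ofReal (H z) ∂m := lintegral_mono_ae hbar
    _ ≤ ∫⁻ z, ENNReal.ofReal (H z) ∂ν := hmass
    _ = ∫⁻ z in Ioo (0 : ℝ) 1, ENNReal.ofReal (γ * w z) * ENNReal.ofReal (H z) :=
        lintegral_withDensity_eq_lintegral_mul₀
          ((hwint.aestronglyMeasurable.aemeasurable.const_mul γ).ennreal_ofReal)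
          hHvol.ennreal_ofReal
    _ = ∫⁻ z in Ioo (0 : ℝ) 1, ENNReal.ofReal γ * ENNReal.ofReal (w z * G z) := by
        refine setLIntegral_congr_fun measurableSet_Ioo fun z hz => ?_
        simp only [hHpos z hz.1]
        rw [ENNReal.ofReal_mul hγ, ENNReal.ofReal_mul (hpos z hz).le, mul_assoc]
    _ = ENNReal.ofReal γ * ∫⁻ z in Ioo (0 : ℝ) 1, ENNReal.ofReal (w z * G z) :=
        lintegral_const_mul' _ _ ENNReal.ofReal_ne_top
    _ ≤ ENNReal.ofReal γ * ENNReal.ofReal x := by gcongr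
    _ = ENNReal.ofReal (γ * x) := (ENNReal.ofReal_mul hγ).symm

/-- The digital quantile function that spends the whole budget is feasible. -/
lemma feasible_digital {F : ℝ → ℝ} {x c : ℝ} (hx : 0 < x) (hc : c ∈ Ioo (0 : ℝ) 1)
    (hw : IntegrableOn (fun z => F (1 - z)) (Ioo 0 1))
    (hpos : ∀ z ∈ Ioo (0 : ℝ) 1, 0 < F (1 - z)) (hD : 0 < ∫ t in c..1, F (1 - t)) :
    Feasible F x (fun z => if c ≤ z then x / ∫ t in c..1, F (1 - t) else 0) := by
  set k := x / ∫ t in c..1, F (1 - t) with hk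
  have hk0 : 0 < k := div_pos hx hD
  refine ⟨?_, fun z hz => ?_, ⟨0, le_rfl, ?_⟩, le_of_eq ?_⟩
  · intro a _ b _ hab
    by_cases ha : c ≤ a
    · simp [ha, ha.trans hab]
    · simp only [ha, if_false]
      split_ifs
      exacts [hk0.le, le_rfl]
  · refine tendsto_nhds_of_eventually_eq ?_
    by_cases h : c ≤ z
    · filter_upwards [self_mem_nhdsWithin] with y hy
      simp [h, h.trans (le_of_lt hy)]
    · filter_upwards [Ioo_mem_nhdsGT (not_le.1 h)] with y hy
      simp [h, hy.2.not_ge]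
  · refine tendsto_nhds_of_eventually_eq ?_
    filter_upwards [Ioo_mem_nhdsGT hc.1] with y hy
    simp [hy.2.not_ge]
  · have hind : ∀ z, ENNReal.ofReal (F (1 - z) * if c ≤ z then k else 0)
        = (Ici c).indicator (fun z => ENNReal.ofReal (k * F (1 - z))) z := by
      intro z
      by_cases h : c ≤ z <;> simp [h, mul_comm]
    have hset : Ici c ∩ Ioo 0 1 = Ico c 1 := by
      ext z
      exact ⟨fun h => ⟨h.1, h.2.2⟩, fun h => ⟨h.1, hc.1.trans_le h.1, h.2⟩⟩
    have hsub : Ico c 1 ⊆ Ioo 0 1 := fun z hz => ⟨hc.1.trans_le hz.1, hz.2⟩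
    simp_rw [hind]
    rw [lintegral_indicator measurableSet_Ici, Measure.restrict_restrict measurableSet_Ici, hset,
      ← ofReal_integral_eq_lintegral_ofReal ((hw.mono_set hsub).const_mul k), integral_const_mul,
      integral_Ico_eq_integral_Ioo, ← integral_Ioc_eq_integral_Ioo,
      ← intervalIntegral.integral_of_le hc.2.le, hk, div_mul_cancel₀ _ hD.ne']
    filter_upwards [ae_restrict_mem measurableSet_Ico] with z hz
    exact mul_nonneg hk0.le (hpos z (hsub hz)).le

/-- The objective value of a digital quantile function. -/
lemma objVal_digital {m : Measure ℝ} (hm : m (Icc (0 : ℝ) 1)ᶜ = 0) {c : ℝ}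
    (hc : c ∈ Ioo (0 : ℝ) 1) (k : ℝ) :
    objVal m (fun z => if c ≤ z then k else 0) = ENNReal.ofReal k * m (Icc c 1) := by
  rw [← lintegral_indicator_const measurableSet_Icc, objVal]
  refine lintegral_congr_ae ?_
  have hmae : ∀ᵐ z ∂m, z ∈ Icc (0 : ℝ) 1 := hm
  filter_upwards [hmae] with z hz
  rcases hz.1.eq_or_lt with rfl | h0
  · rw [indicator_of_notMem (fun h => hc.1.not_ge h.1), Gbar, if_pos rfl]
    have hy : c / 2 ∈ Ioo (0 : ℝ) 1 := ⟨by linarith [hc.1], by linarith [hc.1, hc.2]⟩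
    refine le_antisymm ((iInf₂_le _ hy).trans ?_) zero_le
    rw [if_neg (by linarith [hc.1]), ENNReal.ofReal_zero]
  rcases hz.2.eq_or_lt with rfl | h1
  · rw [indicator_of_mem (right_mem_Icc.2 hc.2.le), Gbar, if_neg one_ne_zero, if_pos rfl]
    refine le_antisymm (iSup₂_le fun y _ => ?_) ?_
    · split_ifs <;> simp
    · refine le_trans ?_ (le_iSup₂ c hc)
      simp
  · rw [Gbar, if_neg h0.ne', if_neg h1.ne]
    by_cases h : c ≤ z
    · simp [h, h1.le]
    · simp [h]

/-- if `1/δ < γ* < +∞` and the supremum of `ζ` is attained at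
`c* ∈ (0,1)`, then `G*(z) = k*·1_{z ≥ c*}` with `k* = x / ∫_{c*}^1 F_ρ⁻¹(1-z) dz`
is feasible, has objective value `γ*·x = ζ(c*)·x`, and is optimal. -/
theorem digital_optimal_of_attained
    {Ω : Type*} [MeasurableSpace Ω] (μ : Measure Ω) [IsProbabilityMeasure μ]
    (ρ : Ω → ℝ) (hρmeas : Measurable ρ) (hρpos : ∀ ω, 0 < ρ ω)
    (hρint : Integrable ρ μ) (hcdf : Continuous (cdfFun μ ρ))
    (m : Measure ℝ) [IsProbabilityMeasure m] (hm : m (Set.Icc (0:ℝ) 1)ᶜ = 0)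
    (x δ : ℝ) (hx : 0 < x) (hδpos : 0 < δ)
    (hδ1 : δ = ∫ ω, ρ ω ∂μ) (hδ2 : δ = ∫ z in (0:ℝ)..1, rcInv μ ρ (1 - z))
    (cstar : ℝ) (hc : cstar ∈ Set.Ioo (0:ℝ) 1)
    (hattain : ∀ c ∈ Set.Ioo (0:ℝ) 1, zeta (rcInv μ ρ) m c ≤ zeta (rcInv μ ρ) m cstar)
    (hgt : 1 / δ < zeta (rcInv μ ρ) m cstar) :
    Feasible (rcInv μ ρ) x
        (fun z => if cstar ≤ z then x / ∫ t in cstar..1, rcInv μ ρ (1 - t) else 0)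
    ∧ objVal m (fun z => if cstar ≤ z then x / ∫ t in cstar..1, rcInv μ ρ (1 - t) else 0)
        = ENNReal.ofReal (zeta (rcInv μ ρ) m cstar * x)
    ∧ ∀ G : ℝ → ℝ, Feasible (rcInv μ ρ) x G →
        objVal m G ≤
          objVal m (fun z => if cstar ≤ z then x / ∫ t in cstar..1, rcInv μ ρ (1 - t) else 0) := by
  set F := rcInv μ ρ
  set γ := zeta F m cstar with hγdef
  have hpos : ∀ z ∈ Ioo (0 : ℝ) 1, 0 < F (1 - z) := fun z hz =>
    rcInv_pos μ hρmeas hρpos hcdf ⟨by linarith [hz.2], by linarith [hz.1]⟩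
  have hw : IntervalIntegrable (fun z => F (1 - z)) volume 0 1 := by
    by_contra h
    rw [intervalIntegral.integral_undef h] at hδ2
    exact hδpos.ne' hδ2
  have hwint : IntegrableOn (fun z => F (1 - z)) (Ioo 0 1) :=
    ((intervalIntegrable_iff_integrableOn_Ioc_of_le zero_le_one).1 hw).mono_set Ioo_subset_Ioc_self
  have hD : ∀ c ∈ Ioo (0 : ℝ) 1, 0 < ∫ z in c..1, F (1 - z) := fun c hc =>
    intervalIntegral.intervalIntegral_pos_of_pos_on
      (hw.mono_set (by
        rw [uIcc_of_le hc.2.le, uIcc_of_le zero_le_one]; exact Icc_subset_Icc_left hc.1.le))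
      (fun z hz => hpos z ⟨hc.1.trans hz.1, hz.2⟩) hc.2
  have hγ : 0 < γ := (one_div_pos.2 hδpos).trans hgt
  have htail : ∀ c ∈ Ioo (0 : ℝ) 1,
      m (Icc c 1) ≤ ENNReal.ofReal (γ * ∫ z in c..1, F (1 - z)) := by
    intro c hc'
    rw [← ENNReal.ofReal_toReal (measure_ne_top m (Icc c 1))]
    exact ENNReal.ofReal_le_ofReal ((div_le_iff₀ (hD c hc')).1 (hattain c hc'))
  have htot : 1 ≤ ENNReal.ofReal (γ * ∫ z in (0 : ℝ)..1, F (1 - z)) := by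
    rw [← hδ2, ENNReal.one_le_ofReal]
    exact ((div_lt_iff₀ hδpos).1 hgt).le
  have hval : objVal m (fun z => if cstar ≤ z then x / ∫ t in cstar..1, F (1 - t) else 0)
      = ENNReal.ofReal (γ * x) := by
    rw [objVal_digital hm hc, ← ENNReal.ofReal_toReal (measure_ne_top m (Icc cstar 1)),
      ← ENNReal.ofReal_mul (div_pos hx (hD cstar hc)).le, hγdef, zeta]
    congr 1
    ring
  refine ⟨feasible_digital hx hc hwint hpos (hD cstar hc), hval, fun G hG => ?_⟩
  rw [hval]
  exact objVal_le hγ.le hw hpos hm htail htot hG
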